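/- Let σ₁, σ₂, λ : ℝ → ℝ be differentiable functions satisfying σ₁′(t) = (1/2)λ(t) − 1/4, σ₂′(t) = −(1/2)λ(t) + 1/4, and λ′(t) = (1/2)(σ₁(t) − σ₂(t)) for all t, with σ₁(0) = σ₂(0) and λ(0) = λ₀ ∈ (1/2, 1). Then there exists t > 0 with λ(t) = 1; i.e., the shared executor parameter reaches 1 in finite time. -/

import Mathlib

theorem exp_aux (f : ℝ → ℝ) (c : ℝ) (h : ∀ t, HasDerivAt f (c * f t) t) (t : ℝ) :
    f t = f 0 * Real.exp (c * t) := by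
  have hd : ∀ s, HasDerivAt (fun s => f s * Real.exp (-(c * s))) 0 s := by
    intro s
    have h2 : HasDerivAt (fun s : ℝ => -(c * s)) (-(c * 1)) s :=
      ((hasDerivAt_id s).const_mul c).neg
    have h3 := (h s).mul h2.exp
    exact h3.congr_deriv (by ring)
  have hc := is_const_of_deriv_eq_zero (fun s => (hd s).differentiableAt)
    (fun s => (hd s).deriv) t 0
  simp only [mul_zero, neg_zero, Real.exp_zero, mul_one] at hc
  rw [← hc, mul_assoc, ← Real.exp_add]
  simp

theorem stmt_17 (σ₁ σ₂ lam : ℝ → ℝ) (lam₀ : ℝ)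
    (hσ₁ : ∀ t, HasDerivAt σ₁ ((1/2) * lam t - 1/4) t)
    (hσ₂ : ∀ t, HasDerivAt σ₂ (-(1/2) * lam t + 1/4) t)
    (hlam : ∀ t, HasDerivAt lam ((1/2) * (σ₁ t - σ₂ t)) t)
    (hinit : σ₁ 0 = σ₂ 0) (hlam0 : lam 0 = lam₀)
    (hlam₀ : lam₀ ∈ Set.Ioo (1/2 : ℝ) 1) :
    ∃ t : ℝ, 0 < t ∧ lam t = 1 := by
  obtain ⟨h1, h2⟩ := hlam₀
  obtain ⟨k, hk, hkk⟩ : ∃ k : ℝ, 0 < k ∧ k * k = 1/2 :=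
    ⟨√(1/2), by positivity, Real.mul_self_sqrt (by norm_num)⟩
  have key : ∀ c : ℝ, c * c = 1/2 → ∀ t,
      lam t - 1/2 + c * (σ₁ t - σ₂ t) = (lam₀ - 1/2) * Real.exp (c * t) := by
    intro c hc t
    have := exp_aux (fun t => lam t - 1/2 + c * (σ₁ t - σ₂ t)) c (fun s => by
      have h3 := ((hlam s).sub_const (1/2)).add (((hσ₁ s).sub (hσ₂ s)).const_mul c)
      exact h3.congr_deriv (by linear_combination -(σ₁ s - σ₂ s) * hc)) t
    simpa [hinit, hlam0] using this
  have hu : 0 < lam₀ - 1/2 := by linarith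
  set T := 1 / ((lam₀ - 1/2) * k) with hT
  have hTpos : 0 < T := by positivity
  have hp := key k hkk T
  have hq := key (-k) (by linarith) T
  have hkT : (lam₀ - 1/2) * (k * T) = 1 := by 
    rw [hT, ← mul_assoc]; exact mul_one_div_cancel (by positivity)
  have he := Real.add_one_le_exp (k * T)
  have he' := mul_le_mul_of_nonneg_left he hu.le
  have hq' : 0 < (lam₀ - 1/2) * Real.exp (-k * T) := by positivity
  have hbig : 1 ≤ lam T := by nlinarith
  have hcont : Continuous lam := continuous_iff_continuousAt.2 fun t => (hlam t).continuousAt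
  obtain ⟨t, ht, ht1⟩ := intermediate_value_Icc hTpos.le hcont.continuousOn
    (show (1:ℝ) ∈ Set.Icc (lam 0) (lam T) from ⟨by linarith, hbig⟩)
  refine ⟨t, lt_of_le_of_ne ht.1 ?_, ht1⟩
  rintro rfl
  linarith
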